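/- There is a constant c > 0 such that the following holds. Let F be any field, let n ≥ 2, and let h : {0,1}^n → {0,1} be a symmetric Boolean function with b := B(h) satisfying 1 ≤ b ≤ ⌈n/3⌉ and with Spec h(i) = 0 for all i in the integer interval [b, n−b]. Then for every ε ∈ [2^{−n}, 1/3], pdeg^F_ε(h) ≥ c·(√(b·log(1/ε)) + log(1/ε)) / log n. -/

import Mathlib

noncomputable section

open scoped BigOperators

/-- Embed a Boolean value into a field: `true ↦ 1`, `false ↦ 0`. -/
def bF (F : Type) [Field F] (b : Bool) : F := if b then 1 else 0

/-- A finitely supported probability distribution on polynomials in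
`F[x_1,…,x_n]` (a probabilistic polynomial). -/
structure ProbPoly (F : Type) [Field F] (n : ℕ) where
  k : ℕ
  w : Fin k → ℝ
  w_nonneg : ∀ i, 0 ≤ w i
  w_sum : ∑ i, w i = 1
  poly : Fin k → MvPolynomial (Fin n) F

open Classical in
/-- The probability that the probabilistic polynomial `P` errs on input `a`
with respect to the Boolean function `f`. -/
def errAt {F : Type} [Field F] {n : ℕ} (P : ProbPoly F n)
    (f : (Fin n → Bool) → Bool) (a : Fin n → Bool) : ℝ :=
  ∑ i, if MvPolynomial.eval (fun v => bF F (a v)) (P.poly i) = bF F (f a) then 0 else P.w i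

/-- The ε-error probabilistic degree of a Boolean function over `F`: the least `d`
such that some probabilistic polynomial of degree at most `d` computes `f` with
error at most `ε` at each point. -/
def pdeg (F : Type) [Field F] {n : ℕ} (f : (Fin n → Bool) → Bool) (ε : ℝ) : ℕ :=
  sInf {d | ∃ P : ProbPoly F n, (∀ i, (P.poly i).totalDegree ≤ d) ∧ ∀ a, errAt P f a ≤ ε}

/-- Hamming weight of a Boolean input. -/
def wt {n : ℕ} (a : Fin n → Bool) : ℕ := (Finset.univ.filter fun i => a i = true).card

/-- The period of a spectrum: the least `b ≥ 1` with `spec i = spec (i+b)`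
whenever `i + b ≤ n`. -/
def period (n : ℕ) (spec : ℕ → Bool) : ℕ :=
  sInf {b | 1 ≤ b ∧ ∀ i, i + b ≤ n → spec i = spec (i + b)}

/-- `B(f)`: the least `k` such that the spectrum is constant on `[k, n-k]`. -/
def Bparam (n : ℕ) (spec : ℕ → Bool) : ℕ :=
  sInf {k | ∀ i j, k ≤ i → i + k ≤ n → k ≤ j → j + k ≤ n → spec i = spec j}

/-- The monomial function of a set of variables. -/
def chiF (F : Type) [Field F] {σ : Type} (T : Finset σ) : (σ → Bool) → F :=
  fun x => ∏ i ∈ T, bF F (x i)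

/-- Functions on the cube of degree at most `d`. -/
def VV (F : Type) [Field F] (σ : Type) (d : ℕ) : Submodule F ((σ → Bool) → F) :=
  Submodule.span F (chiF F '' {T : Finset σ | T.card ≤ d})

lemma bF_mul_self (F : Type) [Field F] (b : Bool) : bF F b * bF F b = bF F b := by
  cases b <;> simp [bF]

lemma chiF_mem {F : Type} [Field F] {σ : Type} (T : Finset σ) {d : ℕ} (h : T.card ≤ d) :
    chiF F T ∈ VV F σ d := Submodule.subset_span ⟨T, h, rfl⟩

lemma VV_mono {F : Type} [Field F] {σ : Type} {d e : ℕ} (h : d ≤ e) : VV F σ d ≤ VV F σ e :=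
  Submodule.span_mono (Set.image_mono fun _ hT => le_trans hT h)

lemma one_mem_VV {F : Type} [Field F] {σ : Type} (d : ℕ) : (1 : (σ → Bool) → F) ∈ VV F σ d := by
  have := chiF_mem (F := F) (σ := σ) ∅ (d := d) (by simp)
  convert this using 1
  ext x; simp [chiF]

lemma const_mem_VV {F : Type} [Field F] {σ : Type} (d : ℕ) (c : F) :
    (fun _ => c : (σ → Bool) → F) ∈ VV F σ d := by
  have := (VV F σ d).smul_mem c (one_mem_VV d)
  convert this using 1
  ext x; simp

lemma chiF_mul {F : Type} [Field F] {σ : Type} [DecidableEq σ] (T U : Finset σ) :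
    chiF F T * chiF F U = chiF F (T ∪ U) := by
  ext x
  simp only [chiF, Pi.mul_apply]
  induction T using Finset.induction_on with
  | empty => simp
  | insert a T ha ih =>
    rw [Finset.prod_insert ha, mul_assoc, ih, Finset.insert_union]
    by_cases h : a ∈ T ∪ U
    · rw [Finset.insert_eq_of_mem h, ← Finset.mul_prod_erase _ _ h, ← mul_assoc, bF_mul_self]
    · rw [Finset.prod_insert h]

lemma mul_mem_VV {F : Type} [Field F] {σ : Type} {d e : ℕ} {f g : (σ → Bool) → F}
    (hf : f ∈ VV F σ d) (hg : g ∈ VV F σ e) : f * g ∈ VV F σ (d + e) := by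
  classical
  have h := Submodule.mul_mem_mul hf hg
  unfold VV at h
  rw [Submodule.span_mul_span] at h
  refine Submodule.span_mono ?_ h
  rintro _ ⟨_, ⟨T, hT, rfl⟩, _, ⟨U, hU, rfl⟩, rfl⟩
  refine ⟨T ∪ U, ?_, (chiF_mul T U).symm⟩
  have := Finset.card_union_le T U
  simp only [Set.mem_ofPred_eq] at *
  omega

lemma prod_mem_VV {F : Type} [Field F] {σ α : Type} {d : ℕ} (T : Finset α)
    (f : α → (σ → Bool) → F) (hf : ∀ i ∈ T, f i ∈ VV F σ d) :
    (fun x => ∏ i ∈ T, f i x) ∈ VV F σ (T.card * d) := by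
  classical
  induction T using Finset.induction_on with
  | empty => simpa using const_mem_VV 0 (1 : F)
  | insert a T ha ih =>
    rw [Finset.card_insert_of_notMem ha]
    have := mul_mem_VV (hf a (by simp)) (ih fun i hi => hf i (by simp [hi]))
    rw [Nat.succ_mul, add_comm]
    convert this using 1
    ext x; simp [Finset.prod_insert ha]

lemma sum_mem_VV {F : Type} [Field F] {σ α : Type} {d : ℕ} (T : Finset α)
    (f : α → (σ → Bool) → F) (hf : ∀ i ∈ T, f i ∈ VV F σ d) :
    (fun x => ∑ i ∈ T, f i x) ∈ VV F σ d := by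
  have := (VV F σ d).sum_mem hf
  convert this using 1
  ext x; simp

lemma coord_mem_VV {F : Type} [Field F] {σ : Type} (i : σ) :
    (fun x => bF F (x i)) ∈ VV F σ 1 := by
  have := chiF_mem (F := F) ({i} : Finset σ) (d := 1) (by simp)
  convert this using 1
  ext x; simp [chiF]

lemma comp_mem_VV {F : Type} [Field F] {σ τ : Type} {d : ℕ} (φ : (τ → Bool) → (σ → Bool))
    (hφ : ∀ v, (fun x => bF F (φ x v)) ∈ VV F τ 1) {f : (σ → Bool) → F} (hf : f ∈ VV F σ d) :
    (fun x => f (φ x)) ∈ VV F τ d := by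
  unfold VV at hf
  induction hf using Submodule.span_induction with
  | mem x hx =>
    obtain ⟨T, hT, rfl⟩ := hx
    have := prod_mem_VV T (fun v x => bF F (φ x v)) (fun i _ => hφ i)
    exact VV_mono (by simpa using hT) this
  | zero => exact (VV F τ d).zero_mem
  | add x y _ _ hx hy => exact (VV F τ d).add_mem hx hy
  | smul a x _ hx => exact (VV F τ d).smul_mem a hx

lemma eval_mem_VV {F : Type} [Field F] {n d : ℕ} (P : MvPolynomial (Fin n) F)
    (hP : P.totalDegree ≤ d) :
    (fun a : Fin n → Bool => MvPolynomial.eval (fun v => bF F (a v)) P) ∈ VV F (Fin n) d := by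
  have : (fun a : Fin n → Bool => MvPolynomial.eval (fun v => bF F (a v)) P) =
      fun a => ∑ e ∈ P.support, P.coeff e * ∏ i ∈ e.support, bF F (a i) ^ e i := by
    ext a; rw [MvPolynomial.eval_eq]
  rw [this]
  refine sum_mem_VV _ _ fun e he => ?_
  have h2 : (fun a : Fin n → Bool => P.coeff e * ∏ i ∈ e.support, bF F (a i) ^ e i) =
      P.coeff e • chiF F e.support := by
    ext a
    simp only [chiF, Pi.smul_apply, smul_eq_mul]
    congr 1
    refine Finset.prod_congr rfl fun i hi => ?_
    have : e i ≠ 0 := by simpa using hi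
    cases a i <;> simp [bF, this]
  rw [h2]
  refine Submodule.smul_mem _ _ (chiF_mem _ ?_)
  refine le_trans ?_ ((MvPolynomial.le_totalDegree he).trans hP)
  rw [Finsupp.sum, Finset.card_eq_sum_ones]
  refine Finset.sum_le_sum fun i hi => ?_
  have : e i ≠ 0 := by simpa using hi
  omega

/-- alternating sums of low degree functions vanish -/
lemma alt_sum_zero {F : Type} [Field F] {m d : ℕ} (hd : d < m) {f : (Fin m → Bool) → F}
    (hf : f ∈ VV F (Fin m) d) :
    ∑ x : Fin m → Bool, (∏ i, if x i then (-1 : F) else 1) * f x = 0 := by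
  unfold VV at hf
  induction hf using Submodule.span_induction with
  | mem x hx =>
    obtain ⟨T, hT, rfl⟩ := hx
    have h1 : ∀ x : Fin m → Bool, (∏ i, if x i then (-1 : F) else 1) * chiF F T x =
        ∏ i, (if x i then (-1 : F) else 1) * (if i ∈ T then bF F (x i) else 1) := by
      intro x
      rw [Finset.prod_mul_distrib]
      congr 1
      simp [chiF, Finset.prod_ite_mem]
    simp_rw [h1]
    rw [← Fintype.prod_sum (fun i (y : Bool) => (if y then (-1 : F) else 1) * (if i ∈ T then bF F y else 1))]
    have : ∃ i, i ∉ T := by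
      by_contra hcon
      push Not at hcon
      have : T = Finset.univ := by ext i; simp [hcon i]
      subst this
      simp at hT; omega
    obtain ⟨i, hi⟩ := this
    exact Finset.prod_eq_zero (Finset.mem_univ i) (by simp [hi])
  | zero => simp
  | add x y _ _ hx hy => simp [mul_add, Finset.sum_add_distrib, hx, hy]
  | smul a x _ hx =>
    have : ∀ z, (∏ i, if z i then (-1 : F) else 1) * (a • x) z =
      a * ((∏ i, if z i then (-1 : F) else 1) * x z) := by
      intro z; simp; ring
    simp_rw [this, ← Finset.mul_sum, hx, mul_zero]

lemma wt_append {m j : ℕ} (x : Fin m → Bool) (y : Fin j → Bool) :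
    wt (Fin.append x y) = wt x + wt y := by
  simp only [wt, Finset.card_filter]
  rw [Fin.sum_univ_add]
  simp

lemma wt_const_true (j : ℕ) : wt (fun _ : Fin j => true) = j := by simp [wt]
lemma wt_const_false (j : ℕ) : wt (fun _ : Fin j => false) = 0 := by simp [wt]

lemma wt_le {m : ℕ} (x : Fin m → Bool) : wt x ≤ m := by
  have := Finset.card_filter_le (Finset.univ : Finset (Fin m)) (fun i => x i = true)
  simpa [wt] using this

lemma wt_not {m : ℕ} (x : Fin m → Bool) : wt (fun i => !x i) + wt x = m := by
  have := Finset.card_filter_add_card_filter_not (s := (Finset.univ : Finset (Fin m))) (fun i => x i = true)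
  simp only [wt, Finset.card_univ, Fintype.card_fin] at *
  simp only [Bool.not_eq_true] at this
  simp
  omega

lemma exists_emb (F : Type) [Field F] {m j n : ℕ} (h : m + j ≤ n) :
    ∃ φ : (Fin m → Bool) → (Fin n → Bool), (∀ x, wt (φ x) = wt x + j) ∧
      ∀ v, (fun x => bF F (φ x v)) ∈ VV F (Fin m) 1 := by
  obtain ⟨l, rfl⟩ := Nat.exists_eq_add_of_le h
  refine ⟨fun x => Fin.append (Fin.append x (fun _ : Fin j => true)) (fun _ : Fin l => false),
    fun x => ?_, fun v => ?_⟩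
  · rw [wt_append, wt_append, wt_const_true, wt_const_false]; omega
  · refine Fin.addCases (fun v => ?_) (fun v => ?_) v
    · refine Fin.addCases (fun v => ?_) (fun v => ?_) v
      · simpa using coord_mem_VV v
      · simpa using const_mem_VV 1 _
    · simpa using const_mem_VV 1 _

/-- probabilistic low degree function for the relevant promise problem -/
def Good (F : Type) [Field F] (n b d : ℕ) (ε : ℝ) : Prop :=
  ∃ (ι : Type) (_ : Fintype ι) (w : ι → ℝ) (p : ι → (Fin n → Bool) → F),
    (∀ i, 0 ≤ w i) ∧ ∑ i, w i = 1 ∧ (∀ i, p i ∈ VV F (Fin n) d) ∧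
    ∀ a, b - 1 ≤ wt a → wt a + b ≤ n →
      (∑ i, open Classical in if p i a = bF F (decide (wt a = b - 1)) then 0 else w i) ≤ ε

lemma Good.mono {F : Type} [Field F] {n b d d' : ℕ} {ε ε' : ℝ} (h : Good F n b d ε)
    (hε : ε ≤ ε') (hd : d ≤ d') : Good F n b d' ε' := by
  obtain ⟨ι, hι, w, p, h1, h2, h3, h4⟩ := h
  exact ⟨ι, hι, w, p, h1, h2, fun i => VV_mono hd (h3 i), fun a ha hb => (h4 a ha hb).trans hε⟩

open Classical in
/-- averaging -/
lemma averaging {ι κ : Type} [Fintype ι] (w : ι → ℝ) (hw : ∀ i, 0 ≤ w i) (hs : ∑ i, w i = 1)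
    (S : Finset κ) (ok : ι → κ → Prop) (B : ℕ) (ε : ℝ)
    (hB : ∀ i, B ≤ (S.filter fun k => ¬ ok i k).card)
    (hε : ∀ k ∈ S, (∑ i, if ok i k then 0 else w i) ≤ ε) : (B : ℝ) ≤ S.card * ε := by
  calc (B : ℝ) = ∑ i, w i * B := by rw [← Finset.sum_mul, hs, one_mul]
    _ ≤ ∑ i, w i * ((S.filter fun k => ¬ ok i k).card : ℝ) :=
        Finset.sum_le_sum fun i _ => mul_le_mul_of_nonneg_left (by exact_mod_cast hB i) (hw i)
    _ = ∑ i, ∑ k ∈ S, if ok i k then 0 else w i := by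
        refine Finset.sum_congr rfl fun i _ => ?_
        rw [Finset.card_filter]
        push_cast
        rw [Finset.mul_sum]
        refine Finset.sum_congr rfl fun k _ => ?_
        by_cases h : ok i k <;> simp [h]
    _ = ∑ k ∈ S, ∑ i, if ok i k then 0 else w i := Finset.sum_comm
    _ ≤ ∑ k ∈ S, ε := Finset.sum_le_sum hε
    _ = S.card * ε := by simp

lemma wt_pos_of_ne {m : ℕ} (x : Fin m → Bool) (hx : x ≠ fun _ => false) : 1 ≤ wt x := by
  by_contra h
  apply hx
  have h0 : wt x = 0 := by omega
  rw [wt, Finset.card_eq_zero, Finset.filter_eq_empty_iff] at h0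
  ext i
  simpa using h0 (Finset.mem_univ i)

lemma Good.nor {F : Type} [Field F] {n b d : ℕ} {ε : ℝ} (h : Good F n b d ε) (hb : 1 ≤ b)
    (hd : d + 2 * b ≤ n) : 1 ≤ (2 : ℝ) ^ (d + 1) * ε := by
  classical
  obtain ⟨ι, hι, w, p, h1, h2, h3, h4⟩ := h
  obtain ⟨φ, hφ, hφ'⟩ := exists_emb F (m := d + 1) (j := b - 1) (n := n) (by omega)
  have := averaging w h1 h2 (Finset.univ : Finset (Fin (d + 1) → Bool))
    (fun i x => p i (φ x) = bF F (decide (wt (φ x) = b - 1))) 1 ε ?_ ?_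
  · simpa using this
  · intro i
    rw [Nat.one_le_iff_ne_zero, Ne, Finset.card_eq_zero, Finset.filter_eq_empty_iff]
    intro hall
    have hz := alt_sum_zero (Nat.lt_succ_self d) (comp_mem_VV φ hφ' (h3 i))
    rw [Finset.sum_eq_single (fun _ => false)] at hz
    · have := hall (Finset.mem_univ (fun _ => false))
      simp only [not_not] at this
      rw [this, hφ, wt_const_false] at hz
      simp [bF] at hz
    · intro x _ hx
      have h5 := hall (Finset.mem_univ x)
      simp only [not_not] at h5
      have := wt_pos_of_ne x hx
      rw [h5, hφ]
      have : ¬ (wt x + (b - 1) = b - 1) := by omega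
      rw [decide_eq_false this]
      simp [bF]
    · simp
  · intro x _
    have := wt_le x
    exact h4 _ (by rw [hφ]; omega) (by rw [hφ]; omega)

lemma slice_rep {F : Type} [Field F] {r k : ℕ} (hk : k ≤ 2 * r) (f : (Fin (2 * r) → Bool) → F) :
    ∃ g ∈ VV F (Fin (2 * r)) r, ∀ x, wt x = k → g x = f x := by
  classical
  let A : (Fin (2 * r) → Bool) → Finset (Fin (2 * r)) := fun y => Finset.univ.filter fun i => y i = true
  have hA : ∀ y, (A y).card = wt y := fun y => rfl
  have hAinj : ∀ x y, A x = A y → x = y := by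
    intro x y h
    ext i
    have : i ∈ A x ↔ i ∈ A y := by rw [h]
    simp only [A, Finset.mem_filter, Finset.mem_univ, true_and] at this
    cases hx : x i <;> cases hy : y i <;> simp_all
  by_cases hkr : k ≤ r
  · refine ⟨fun x => ∑ y ∈ Finset.univ.filter (fun y : Fin (2 * r) → Bool => wt y = k),
      (f y • chiF F (A y)) x, sum_mem_VV _ _ fun y hy => ?_, fun x hx => ?_⟩
    · refine Submodule.smul_mem _ _ (chiF_mem _ ?_)
      simp at hy
      rw [hA]; omega
    · beta_reduce
      rw [Finset.sum_eq_single x]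
      · have : chiF F (A x) x = 1 := by
          refine Finset.prod_eq_one fun i hi => ?_
          have : x i = true := by simpa [A] using hi
          simp [bF, this]
        simp [this]
      · intro y hy hyx
        simp at hy
        have : ∃ i ∈ A y, i ∉ A x := by
          by_contra hcon
          push Not at hcon
          have := Finset.eq_of_subset_of_card_le (s := A y) (t := A x) hcon (by rw [hA, hA]; omega)
          exact hyx (hAinj _ _ this)
        obtain ⟨i, hi, hix⟩ := this
        have : chiF F (A y) x = 0 := by
          refine Finset.prod_eq_zero hi ?_
          have : x i = false := by simpa [A] using hix
          simp [bF, this]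
        simp [this]
      · intro h; simp [hx] at h
  · refine ⟨fun x => ∑ y ∈ Finset.univ.filter (fun y : Fin (2 * r) → Bool => wt y = k),
      (f y • fun z : Fin (2 * r) → Bool => ∏ i ∈ (A y)ᶜ, (1 - bF F (z i))) x,
      sum_mem_VV _ _ fun y hy => ?_, fun x hx => ?_⟩
    · refine Submodule.smul_mem _ _ ?_
      have := prod_mem_VV (d := 1) (A y)ᶜ (fun i (z : Fin (2 * r) → Bool) => 1 - bF F (z i))
        (fun i _ => (VV F _ 1).sub_mem (one_mem_VV 1) (coord_mem_VV i))
      refine VV_mono ?_ this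
      simp at hy
      rw [Finset.card_compl, hA, Fintype.card_fin]; omega
    · beta_reduce
      rw [Finset.sum_eq_single x]
      · have : ∏ i ∈ (A x)ᶜ, (1 - bF F (x i)) = 1 := by
          refine Finset.prod_eq_one fun i hi => ?_
          have : x i = false := by simpa [A] using hi
          simp [bF, this]
        simp [this]
      · intro y hy hyx
        simp at hy
        have : ∃ i ∈ A x, i ∉ A y := by
          by_contra hcon
          push Not at hcon
          have := Finset.eq_of_subset_of_card_le (s := A x) (t := A y) hcon (by rw [hA, hA]; omega)
          exact hyx (hAinj _ _ this).symm
        obtain ⟨i, hi, hix⟩ := this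
        have : ∏ i ∈ (A y)ᶜ, (1 - bF F (x i)) = 0 := by
          refine Finset.prod_eq_zero (i := i) (by simpa using hix) ?_
          have : x i = true := by simpa [A] using hi
          simp [bF, this]
        simp [this]
      · intro h; simp [hx] at h

lemma smolensky_rep {F : Type} [Field F] {r d : ℕ} (E : ℕ → (Fin (2 * r) → Bool) → F)
    (hE : ∀ k ≤ 2 * r, E k ∈ VV F _ d) (S : Set (Fin (2 * r) → Bool))
    (hS : ∀ x ∈ S, ∀ k ≤ wt x, E k x = bF F (decide (wt x = k)))
    (f : (Fin (2 * r) → Bool) → F) :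
    ∃ q ∈ VV F (Fin (2 * r)) (r + d), ∀ x ∈ S, q x = f x := by
  suffices H : ∀ j, j ≤ 2 * r + 1 → ∃ q ∈ VV F (Fin (2 * r)) (r + d), ∀ x ∈ S,
      2 * r + 1 ≤ wt x + j → q x = f x by
    obtain ⟨q, hq, hq'⟩ := H (2 * r + 1) le_rfl
    exact ⟨q, hq, fun x hx => hq' x hx (by omega)⟩
  intro j
  induction j with
  | zero =>
    intro _
    refine ⟨0, Submodule.zero_mem _, fun x _ h => ?_⟩
    have := wt_le x
    omega
  | succ j ih =>
    intro hj
    obtain ⟨q, hq, hq'⟩ := ih (by omega)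
    obtain ⟨g, hg, hg'⟩ := slice_rep (F := F) (r := r) (k := 2 * r - j) (by omega) (f - q)
    refine ⟨q + g * E (2 * r - j), Submodule.add_mem _ hq (mul_mem_VV hg (hE _ (by omega))),
      fun x hx h => ?_⟩
    have h1 := hS x hx (2 * r - j) (by omega)
    simp only [Pi.add_apply, Pi.mul_apply, h1]
    by_cases hw : wt x = 2 * r - j
    · simp [hg' x hw, hw, bF]
    · rw [decide_eq_false hw, hq' x hx (by omega)]
      simp [bF]

open Classical in
lemma smolensky_card {F : Type} [Field F] {r d : ℕ} (E : ℕ → (Fin (2 * r) → Bool) → F)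
    (hE : ∀ k ≤ 2 * r, E k ∈ VV F _ d) (S : Finset (Fin (2 * r) → Bool))
    (hS : ∀ x ∈ S, ∀ k ≤ wt x, E k x = bF F (decide (wt x = k))) :
    (2 * r).choose (r + d + 1) ≤ Sᶜ.card := by
  let K : Finset (Finset (Fin (2 * r))) := Finset.univ.filter fun T => T.card ≤ r + d
  have hV : VV F (Fin (2 * r)) (r + d) = Submodule.span F (K.image (chiF F) : Finset _) := by
    unfold VV
    congr 1
    ext f; simp [K]
  have hfr : Module.finrank F (VV F (Fin (2 * r)) (r + d)) ≤ K.card := by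
    rw [hV]
    exact (finrank_span_finset_le_card _).trans Finset.card_image_le
  let res : ((Fin (2 * r) → Bool) → F) →ₗ[F] (S → F) := LinearMap.funLeft F F Subtype.val
  have htop : (VV F (Fin (2 * r)) (r + d)).map res = ⊤ := by
    rw [eq_top_iff]
    intro f _
    obtain ⟨q, hq, hq'⟩ := smolensky_rep E hE (S : Set _) hS
      (fun x => if h : x ∈ S then f ⟨x, h⟩ else 0)
    refine ⟨q, hq, ?_⟩
    ext ⟨x, hx⟩
    have := hq' x hx
    simp only [hx, dite_true] at this
    simpa [res, LinearMap.funLeft] using this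
  have h1 : S.card ≤ K.card := by
    have h2 := Submodule.finrank_map_le res (VV F (Fin (2 * r)) (r + d))
    rw [htop, finrank_top, Module.finrank_fintype_fun_eq_card, Fintype.card_coe] at h2
    exact h2.trans hfr
  have h3 : (2 * r).choose (r + d + 1) ≤ Kᶜ.card := by
    have : (Finset.univ : Finset (Fin (2 * r))).powersetCard (r + d + 1) ⊆ Kᶜ := by
      intro T hT
      rw [Finset.mem_powersetCard] at hT
      simp [K, hT.2]
    have := Finset.card_le_card this
    simpa using this
  have h4 := Finset.card_add_card_compl K
  have h5 := Finset.card_add_card_compl S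
  have h6 : Fintype.card (Finset (Fin (2 * r))) = Fintype.card (Fin (2 * r) → Bool) := by simp
  omega

lemma Good.smol {F : Type} [Field F] {n b d r : ℕ} {ε : ℝ} (h : Good F n b d ε) (hb : 1 ≤ b)
    (hn : 3 * b ≤ n + 2) (hr : 2 * r + 1 ≤ b) :
    ((2 * r).choose (r + d + 1) : ℝ) ≤ 4 ^ r * (2 * r + 1) * ε := by
  classical
  obtain ⟨ι, hι, w, p, h1, h2, h3, h4⟩ := h
  have hem : ∀ k, ∃ φ : (Fin (2 * r) → Bool) → (Fin n → Bool), (∀ x, wt (φ x) = wt x + (b - 1 - k)) ∧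
      ∀ v, (fun x => bF F (φ x v)) ∈ VV F (Fin (2 * r)) 1 := fun k =>
    exists_emb F (by omega)
  choose φ hφ hφ' using hem
  let Pts : Finset (ℕ × (Fin (2 * r) → Bool)) :=
    (Finset.range (2 * r + 1) ×ˢ Finset.univ).filter fun z => z.1 ≤ wt z.2
  have key := averaging w h1 h2 Pts
    (fun i z => p i (φ z.1 z.2) = bF F (decide (wt (φ z.1 z.2) = b - 1))) 
    ((2 * r).choose (r + d + 1)) ε ?_ ?_
  · have hε : 0 ≤ ε := by
      have := h4 (φ 0 fun _ => false) (by rw [hφ]; omega) (by rw [hφ, wt_const_false]; omega)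
      refine le_trans (Finset.sum_nonneg fun i _ => ?_) this
      split_ifs
      · exact le_rfl
      · exact h1 i
    refine key.trans (mul_le_mul_of_nonneg_right ?_ hε)
    have : Pts.card ≤ (2 * r + 1) * 4 ^ r := by
      refine (Finset.card_filter_le _ _).trans ?_
      simp [pow_mul]
    have h' : ((Pts.card : ℕ) : ℝ) ≤ ((2 * r + 1) * 4 ^ r : ℕ) := by exact_mod_cast this
    push_cast at h'
    linarith
  · intro i
    let bad := Pts.filter fun z => ¬ (p i (φ z.1 z.2) = bF F (decide (wt (φ z.1 z.2) = b - 1)))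
    have h5 := smolensky_card (F := F) (r := r) (d := d) (fun k x => p i (φ k x))
      (fun k _ => comp_mem_VV _ (hφ' k) (h3 i)) ((bad.image Prod.snd)ᶜ) ?_
    · rw [compl_compl] at h5
      exact h5.trans Finset.card_image_le
    · intro x hx k hk
      by_contra hcon
      rw [Finset.mem_compl] at hx
      apply hx
      rw [Finset.mem_image]
      have hwx := wt_le x
      refine ⟨(k, x), ?_, rfl⟩
      simp only [bad, Pts, Finset.mem_filter, Finset.mem_product, Finset.mem_range,
        Finset.mem_univ, and_true]
      refine ⟨⟨by omega, hk⟩, ?_⟩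
      rw [hφ]
      have : (wt x + (b - 1 - k) = b - 1) ↔ wt x = k := by omega
      simpa only [this] using hcon
  · rintro ⟨k, x⟩ hz
    simp only [Pts, Finset.mem_filter, Finset.mem_product, Finset.mem_range,
        Finset.mem_univ, and_true] at hz
    have hwx := wt_le x
    dsimp only at hz ⊢
    exact h4 _ (by rw [hφ]; omega) (by rw [hφ]; omega)

/-- multilinear majority -/
def majP {F : Type} [Field F] {α : Type} [Fintype α] [DecidableEq α] (y : α → F) : F :=
  ∑ T ∈ (Finset.univ : Finset (Finset α)).filter (fun T => Fintype.card α < 2 * T.card),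
    (∏ i ∈ T, y i) * ∏ i ∈ Tᶜ, (1 - y i)

lemma majP_zero {F : Type} [Field F] {α : Type} [Fintype α] [DecidableEq α] (y : α → F)
    (U : Finset α) (hU : Fintype.card α < 2 * U.card) (hy : ∀ i ∈ U, y i = 0) : majP y = 0 := by
  refine Finset.sum_eq_zero fun T hT => ?_
  simp at hT
  have : ∃ i ∈ U, i ∈ T := by
    by_contra hcon
    push Not at hcon
    have : Disjoint U T := Finset.disjoint_left.2 hcon
    have := Finset.card_union_of_disjoint this
    have := Finset.card_le_univ (U ∪ T)
    omega
  obtain ⟨i, hi, hi'⟩ := this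
  rw [Finset.prod_eq_zero hi' (hy i hi), zero_mul]

lemma majP_one {F : Type} [Field F] {α : Type} [Fintype α] [DecidableEq α] (y : α → F)
    (U : Finset α) (hU : Fintype.card α < 2 * U.card) (hy : ∀ i ∈ U, y i = 1) : majP y = 1 := by
  have hall : ∑ T : Finset α, (∏ i ∈ T, y i) * ∏ i ∈ Tᶜ, (1 - y i) = 1 := by
    rw [← Fintype.prod_add]
    simp
  rw [← Finset.sum_filter_add_sum_filter_not _ (fun T => Fintype.card α < 2 * T.card)] at hall
  suffices H : ∑ T ∈ (Finset.univ : Finset (Finset α)).filter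
      (fun T => ¬ Fintype.card α < 2 * T.card), (∏ i ∈ T, y i) * ∏ i ∈ Tᶜ, (1 - y i) = 0 by
    rw [H, add_zero] at hall
    exact hall
  refine Finset.sum_eq_zero fun T hT => ?_
  simp at hT
  have : ∃ i ∈ U, i ∈ Tᶜ := by
    by_contra hcon
    push Not at hcon
    have : U ⊆ T := fun i hi => by simpa using hcon i hi
    have := Finset.card_le_card this
    omega
  obtain ⟨i, hi, hi'⟩ := this
  rw [Finset.prod_eq_zero hi' (by simp [hy i hi]), mul_zero]

lemma majP_mem {F : Type} [Field F] {σ α : Type} [Fintype α] [DecidableEq α] {d : ℕ}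
    (p : α → (σ → Bool) → F) (hp : ∀ i, p i ∈ VV F σ d) :
    (fun x => majP fun i => p i x) ∈ VV F σ (Fintype.card α * d) := by
  refine sum_mem_VV _ _ fun T _ => ?_
  have h1 := prod_mem_VV T p fun i _ => hp i
  have h2 := prod_mem_VV Tᶜ (fun i x => 1 - p i x) fun i _ =>
    (VV F σ d).sub_mem (one_mem_VV d) (hp i)
  have := mul_mem_VV h1 h2
  rw [← add_mul, Finset.card_add_card_compl] at this
  exact this

lemma Good.amplify {F : Type} [Field F] {n b d : ℕ} (h : Good F n b d (1 / 3)) (R : ℕ) :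
    Good F n b (2 * R * d) ((8 / 9 : ℝ) ^ R) := by
  classical
  obtain ⟨ι, hι, w, p, h1, h2, h3, h4⟩ := h
  refine ⟨Fin (2 * R) → ι, inferInstance, fun t => ∏ j, w (t j),
    fun t a => majP fun j => p (t j) a, fun t => Finset.prod_nonneg fun j _ => h1 _, ?_,
    fun t => ?_, fun a ha ha' => ?_⟩
  · rw [← Fintype.prod_sum (fun (_ : Fin (2 * R)) i => w i)]
    simp [h2]
  · have := majP_mem (fun j => p (t j)) (fun j => h3 (t j))
    simpa using this
  · set v := decide (wt a = b - 1) with hv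
    have h5 := h4 a ha ha'
    let c : ι → ℝ := fun i => if p i a = bF F v then 1 else 2
    have hc : ∑ i, w i * c i ≤ 4 / 3 := by
      have : ∀ i, w i * c i = w i + if p i a = bF F v then 0 else w i := by
        intro i; simp only [c]; split_ifs <;> ring
      simp_rw [this]
      rw [Finset.sum_add_distrib, h2]
      linarith
    have hc0 : 0 ≤ ∑ i, w i * c i := Finset.sum_nonneg fun i _ =>
      mul_nonneg (h1 i) (by simp only [c]; split_ifs <;> norm_num)
    have hterm : ∀ t : Fin (2 * R) → ι,
        (if (majP fun j => p (t j) a) = bF F v then 0 else ∏ j, w (t j)) ≤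
          (1 / 2 : ℝ) ^ R * ∏ j, (w (t j) * c (t j)) := by
      intro t
      have hw0 : 0 ≤ ∏ j, w (t j) := Finset.prod_nonneg fun j _ => h1 _
      have hcp : ∏ j, c (t j) =
          2 ^ (Finset.univ.filter fun j => ¬ p (t j) a = bF F v).card := by
        simp only [c, Finset.prod_ite, Finset.prod_const, one_pow, one_mul]
      rw [Finset.prod_mul_distrib, hcp]
      split_ifs with hm
      · positivity
      · have hge : R ≤ (Finset.univ.filter fun j => ¬ p (t j) a = bF F v).card := by
          by_contra hlt
          apply hm
          have hsum := Finset.card_filter_add_card_filter_not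
            (s := (Finset.univ : Finset (Fin (2 * R)))) (fun j => p (t j) a = bF F v)
          rw [Finset.card_univ, Fintype.card_fin] at hsum
          have hU : Fintype.card (Fin (2 * R)) <
              2 * (Finset.univ.filter fun j => p (t j) a = bF F v).card := by
            rw [Fintype.card_fin]; omega
          cases hvv : v with
          | true =>
            rw [hvv] at hU
            simpa [bF] using majP_one _ _ hU (fun i hi => by simpa [bF] using hi)
          | false =>
            rw [hvv] at hU
            simpa [bF] using majP_zero _ _ hU (fun i hi => by simpa [bF] using hi)
        have h2p : (2 : ℝ) ^ R ≤ 2 ^ (Finset.univ.filter fun j => ¬ p (t j) a = bF F v).card :=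
          pow_le_pow_right₀ (by norm_num) hge
        have hh : (1 / 2 : ℝ) ^ R * 2 ^ R = 1 := by rw [← mul_pow]; norm_num
        have : (0:ℝ) ≤ (1 / 2) ^ R := by positivity
        calc ∏ j, w (t j) = (∏ j, w (t j)) * ((1 / 2 : ℝ) ^ R * 2 ^ R) := by rw [hh, mul_one]
          _ ≤ (∏ j, w (t j)) * ((1 / 2 : ℝ) ^ R * 2 ^ (Finset.univ.filter fun j => ¬ p (t j) a = bF F v).card) := by gcongr
          _ = _ := by ring
    refine (Finset.sum_le_sum fun t _ => hterm t).trans ?_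
    rw [← Finset.mul_sum, ← Fintype.prod_sum (fun (_ : Fin (2 * R)) i => w i * c i)]
    simp only [Finset.prod_const, Finset.card_univ, Fintype.card_fin]
    calc (1 / 2 : ℝ) ^ R * (∑ i, w i * c i) ^ (2 * R) ≤ (1 / 2 : ℝ) ^ R * (4 / 3) ^ (2 * R) := by
          gcongr
      _ = (8 / 9 : ℝ) ^ R := by rw [pow_mul, ← mul_pow]; norm_num

lemma Good.lin {F : Type} [Field F] {n b d : ℕ} {ε : ℝ} (h : Good F n b d ε) (hb : 1 ≤ b)
    (hn : 3 * b ≤ n + 2) (hn2 : 2 ≤ n) (hε : ε ≤ 1 / 3) (hε' : 1 / (2 : ℝ) ^ (4 * n) ≤ ε) :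
    Real.logb 2 (1 / ε) ≤ 24 * d := by
  have hpos : 0 < ε := lt_of_lt_of_le (by positivity) hε'
  have hL : ∀ k : ℕ, 1 ≤ 2 ^ k * ε → Real.logb 2 (1 / ε) ≤ k := by
    intro k hk
    rw [Real.logb_le_iff_le_rpow (by norm_num) (by positivity), Real.rpow_natCast]
    rwa [div_le_iff₀ hpos]
  by_cases hd : d + 2 * b ≤ n
  · have h1 := h.nor hb hd
    have h2 := hL _ h1
    have hd1 : 1 ≤ d := by
      by_contra hd0
      have : d = 0 := by omega
      subst this
      norm_num at h1
      linarith
    have : (1 : ℝ) ≤ d := by exact_mod_cast hd1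
    push_cast at h2
    linarith
  · have h2 := hL (4 * n) (by rwa [div_le_iff₀' (by positivity)] at hε')
    have : 4 * n ≤ 24 * d := by omega
    have : ((4 * n : ℕ) : ℝ) ≤ ((24 * d : ℕ) : ℝ) := by exact_mod_cast this
    push_cast at this h2
    linarith

lemma choose_ratio {r s : ℕ} (hs : s < r) (j : ℕ) (hj : j ≤ s) :
    ((2 * r).choose r : ℝ) ≤ (2 * r).choose (r + j) * (((r : ℝ) + s) / (r - s)) ^ j := by
  have hrs : (0 : ℝ) < r - s := by
    have : (s : ℝ) < r := by exact_mod_cast hs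
    linarith
  induction j with
  | zero => simp
  | succ j ih =>
    refine (ih (by omega)).trans ?_
    rw [pow_succ', ← mul_assoc]
    refine mul_le_mul_of_nonneg_right ?_ (by positivity)
    rw [← mul_div_assoc, le_div_iff₀ hrs]
    have h1 := Nat.choose_succ_right_eq (2 * r) (r + j)
    have h2 : 2 * r - (r + j) = r - j := by omega
    rw [h2] at h1
    have h3 : ((2 * r).choose (r + j + 1) : ℝ) * (r + j + 1) = (2 * r).choose (r + j) * (r - j) := by
      have : ((r - j : ℕ) : ℝ) = r - j := by rw [Nat.cast_sub (by omega)]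
      rw [← this]
      exact_mod_cast h1
    have hjs : (j : ℝ) + 1 ≤ s := by exact_mod_cast hj
    calc ((2 * r).choose (r + j) : ℝ) * (r - s) ≤ (2 * r).choose (r + j) * (r - j) := by
          gcongr; linarith
      _ = (2 * r).choose (r + j + 1) * (r + j + 1) := h3.symm
      _ ≤ (2 * r).choose (r + j + 1) * (r + s) := by gcongr ?_ * ?_; linarith

lemma choose_lower {r s : ℕ} (hr : 1 ≤ r) (hs : 3 * s ≤ r) :
    (4 : ℝ) ^ r ≤ 2 * r * ((2 * r).choose (r + s) * Real.exp (3 * s ^ 2 / r)) := by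
  have h1 := Nat.four_pow_le_two_mul_self_mul_centralBinom r hr
  have h1' : (4 : ℝ) ^ r ≤ 2 * r * r.centralBinom := by exact_mod_cast h1
  refine h1'.trans (mul_le_mul_of_nonneg_left ?_ (by positivity))
  rw [Nat.centralBinom_eq_two_mul_choose]
  refine (choose_ratio (r := r) (s := s) (by omega) s le_rfl).trans ?_
  refine mul_le_mul_of_nonneg_left ?_ (by positivity)
  have hr0 : (0 : ℝ) < r := by exact_mod_cast hr
  have hs' : 3 * (s : ℝ) ≤ r := by exact_mod_cast hs
  have hs0 : (0 : ℝ) ≤ s := by positivity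
  have hrs : (0 : ℝ) < r - s := by linarith
  have h2 : ((r : ℝ) + s) / (r - s) ≤ Real.exp (3 * s / r) := by
    refine le_trans ?_ (Real.add_one_le_exp _)
    rw [div_le_iff₀ hrs, div_add_one hr0.ne', div_mul_eq_mul_div, le_div_iff₀ hr0]
    nlinarith
  calc (((r : ℝ) + s) / (r - s)) ^ s ≤ (Real.exp (3 * s / r)) ^ s := by
        gcongr
    _ = Real.exp (3 * s ^ 2 / r) := by
        rw [← Real.exp_nat_mul]; congr 1; ring

lemma Good.sqrtBound {F : Type} [Field F] {n b d : ℕ} {ε : ℝ} (h : Good F n b d ε) (hb : 1 ≤ b)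
    (hn : 3 * b ≤ n + 2) (hn2 : 2 ≤ n) (hε : ε * n ^ 4 ≤ 1) (hε' : 1 / (2 : ℝ) ^ (4 * n) ≤ ε) :
    Real.sqrt (b * Real.logb 2 (1 / ε)) ≤ 48 * d := by
  have hpos : 0 < ε := lt_of_lt_of_le (by positivity) hε'
  have hn2' : (2 : ℝ) ≤ n := by exact_mod_cast hn2
  have hn4 : (16 : ℝ) ≤ (n : ℝ) ^ 4 := by
    calc (16 : ℝ) = 2 ^ 4 := by norm_num
      _ ≤ _ := by gcongr
  have hε16 : ε ≤ 1 / 16 := by nlinarith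
  have hlin := h.lin hb hn hn2 (by linarith) hε'
  set L := Real.logb 2 (1 / ε) with hLdef
  have hL1 : 1 ≤ L := by
    rw [hLdef, Real.le_logb_iff_rpow_le (by norm_num) (by positivity), Real.rpow_one,
      le_div_iff₀ hpos]
    linarith
  have hd0 : (0 : ℝ) < d := by linarith
  have hd1 : 1 ≤ d := by
    have : 0 < d := by exact_mod_cast hd0
    exact this
  have hd1' : (1 : ℝ) ≤ d := by exact_mod_cast hd1
  rw [Real.sqrt_le_left (by positivity)]
  obtain ⟨r, hr1, hr2⟩ : ∃ r, 2 * r + 1 ≤ b ∧ b ≤ 2 * r + 2 := ⟨(b - 1) / 2, by omega, by omega⟩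
  by_cases hr0 : r = 0
  · have : (b : ℝ) ≤ 2 := by exact_mod_cast (by omega : b ≤ 2)
    nlinarith
  have hb4 : (b : ℝ) ≤ 4 * r := by exact_mod_cast (by omega : b ≤ 4 * r)
  have hr0' : (0 : ℝ) < r := by exact_mod_cast (Nat.pos_of_ne_zero hr0)
  by_cases hs : 3 * (d + 1) ≤ r
  · have h1 := h.smol hb hn hr1
    have h2 := choose_lower (Nat.one_le_iff_ne_zero.2 hr0) hs
    rw [← add_assoc] at h2
    set X := Real.exp (3 * ((d + 1 : ℕ) : ℝ) ^ 2 / r) with hX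
    have hXpos : 0 < X := Real.exp_pos _
    have h3 : (4 : ℝ) ^ r ≤ 4 ^ r * (2 * r * (2 * r + 1) * ε * X) := by
      refine h2.trans ?_
      calc 2 * (r : ℝ) * (((2 * r).choose (r + d + 1) : ℝ) * X)
          ≤ 2 * r * ((4 ^ r * (2 * r + 1) * ε) * X) := by gcongr
        _ = _ := by ring
    have h4 : 1 ≤ 2 * r * (2 * r + 1) * ε * X := by
      by_contra hcon
      push Not at hcon
      have : (0:ℝ) < 4 ^ r := by positivity
      nlinarith
    have hrn : 2 * (r : ℝ) + 1 ≤ n := by exact_mod_cast (by omega : 2 * r + 1 ≤ n)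
    have h5 : 1 ≤ (n : ℝ) ^ 2 * (ε * X) := by
      refine h4.trans ?_
      rw [mul_assoc]
      refine mul_le_mul_of_nonneg_right ?_ (by positivity)
      nlinarith
    have h6 : 1 ≤ ε * X ^ 2 := by
      have : 1 ≤ ((n : ℝ) ^ 2 * (ε * X)) ^ 2 := one_le_pow₀ h5
      have h7 : ((n : ℝ) ^ 2 * (ε * X)) ^ 2 = (ε * n ^ 4) * (ε * X ^ 2) := by ring
      have h8 : 0 ≤ ε * X ^ 2 := by positivity
      nlinarith
    have h7 : Real.log (1 / ε) ≤ 6 * ((d + 1 : ℕ) : ℝ) ^ 2 / r := by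
      rw [Real.log_le_iff_le_exp (by positivity), div_le_iff₀' hpos]
      have hXX : Real.exp (6 * ((d + 1 : ℕ) : ℝ) ^ 2 / r) = X ^ 2 := by
        rw [hX, ← Real.exp_nat_mul]; congr 1; push_cast; ring
      rw [hXX]
      exact h6
    have h8 : L * Real.log 2 = Real.log (1 / ε) := by
      rw [hLdef, Real.logb, div_mul_cancel₀]
      exact (Real.log_pos (by norm_num)).ne'
    have hlog2 := Real.log_two_gt_d9
    rw [← h8, le_div_iff₀ hr0'] at h7
    have h9 : L * r ≤ 36 * (d : ℝ) ^ 2 := by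
      have : ((d + 1 : ℕ) : ℝ) ≤ 2 * d := by push_cast; linarith
      have h10 : ((d + 1 : ℕ) : ℝ) ^ 2 ≤ (2 * d) ^ 2 := by gcongr
      have h11 : L * (2 / 3) * r ≤ L * Real.log 2 * r := by gcongr; linarith
      nlinarith
    nlinarith
  · have : (r : ℝ) ≤ 6 * d := by exact_mod_cast (by omega : r ≤ 6 * d)
    have h1 : (b : ℝ) * L ≤ (4 * r) * L := by gcongr
    have h2 : (r : ℝ) * L ≤ (6 * d) * (24 * d) := by gcongr
    nlinarith

lemma Good.final {F : Type} [Field F] {n b d : ℕ} {ε : ℝ} (h : Good F n b d ε) (hb : 1 ≤ b)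
    (hn : 3 * b ≤ n + 2) (hn2 : 2 ≤ n) (hε : ε ≤ 1 / 3) (hε' : 1 / (2 : ℝ) ^ n ≤ ε) :
    Real.sqrt (b * Real.logb 2 (1 / ε)) + Real.logb 2 (1 / ε) ≤ 5000 * d * Real.logb 2 n := by
  have hpos : 0 < ε := lt_of_lt_of_le (by positivity) hε'
  have hn2' : (2 : ℝ) ≤ n := by exact_mod_cast hn2
  have hn0 : (0 : ℝ) < n := by linarith
  have hlg : 1 ≤ Real.logb 2 n := by
    rw [Real.le_logb_iff_rpow_le (by norm_num) hn0, Real.rpow_one]; exact hn2'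
  have hε4 : 1 / (2 : ℝ) ^ (4 * n) ≤ ε := by
    refine le_trans ?_ hε'
    refine one_div_le_one_div_of_le (by positivity) (pow_le_pow_right₀ (by norm_num) (by omega))
  have hlin := h.lin hb hn hn2 hε hε4
  have hd0 : (0 : ℝ) ≤ d := by positivity
  by_cases hc : ε * n ^ 4 ≤ 1
  · have := h.sqrtBound hb hn hn2 hc hε4
    nlinarith
  · push Not at hc
    set q := Nat.clog 2 n with hq
    have hnq : n ≤ 2 ^ q := Nat.le_pow_clog (by norm_num) n
    have hnq' : (n : ℝ) ≤ 2 ^ q := by exact_mod_cast hnq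
    have hq2 : (q : ℝ) ≤ 2 * Real.logb 2 n := by
      have h1 : 2 ^ (q - 1) < n := Nat.pow_pred_clog_lt_self (by norm_num) (by omega)
      have hq1 : 1 ≤ q := Nat.clog_pos (by norm_num) (by omega)
      have h2 : ((q - 1 : ℕ) : ℝ) ≤ Real.logb 2 n := by
        rw [Real.le_logb_iff_rpow_le (by norm_num) hn0, Real.rpow_natCast]
        exact_mod_cast h1.le
      rw [Nat.cast_sub hq1] at h2
      push_cast at h2
      linarith
    have hA := (h.mono hε le_rfl).amplify (24 * q)
    have hδ : (8 / 9 : ℝ) ^ (24 * q) ≤ 1 / (n : ℝ) ^ 4 := by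
      calc (8 / 9 : ℝ) ^ (24 * q) = ((8 / 9 : ℝ) ^ 24) ^ q := by rw [pow_mul]
        _ ≤ (1 / 2 ^ 4) ^ q := by gcongr; norm_num
        _ = 1 / ((2 : ℝ) ^ q) ^ 4 := by rw [one_div_pow, ← pow_mul, ← pow_mul, mul_comm]
        _ ≤ _ := by gcongr
    have hB := hA.mono hδ le_rfl
    have hn2n : (n : ℝ) ≤ 2 ^ n := by exact_mod_cast Nat.lt_two_pow_self.le
    have h1 := hB.sqrtBound hb hn hn2 (by rw [div_mul_cancel₀]; positivity) (by
      rw [mul_comm, pow_mul]; gcongr)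
    have h2 : Real.logb 2 (1 / ε) ≤ Real.logb 2 (1 / (1 / (n : ℝ) ^ 4)) := by
      refine Real.logb_le_logb_of_le (by norm_num) (by positivity) ?_
      rw [one_div_one_div, div_le_iff₀ hpos]
      linarith
    have h3 : Real.sqrt (b * Real.logb 2 (1 / ε)) ≤ Real.sqrt (b * Real.logb 2 (1 / (1 / (n : ℝ) ^ 4))) := by
      gcongr
    push_cast at h1
    have h4 : d * (q : ℝ) ≤ d * (2 * Real.logb 2 n) := by gcongr
    have h5 : (d : ℝ) * 1 ≤ d * Real.logb 2 n := by gcongr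
    nlinarith

lemma exists_poly (F : Type) [Field F] {n : ℕ} (f : (Fin n → Bool) → Bool) :
    ∃ p : MvPolynomial (Fin n) F, ∀ a, MvPolynomial.eval (fun v => bF F (a v)) p = bF F (f a) := by
  classical
  refine ⟨∑ y : Fin n → Bool, MvPolynomial.C (bF F (f y)) *
    ∏ i, (if y i then MvPolynomial.X i else 1 - MvPolynomial.X i), fun a => ?_⟩
  rw [map_sum, Finset.sum_eq_single a]
  · rw [map_mul, MvPolynomial.eval_C, map_prod, Finset.prod_eq_one, mul_one]
    intro i _
    cases h : a i <;> simp [bF, h]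
  · intro y _ hy
    obtain ⟨i, hi⟩ := Function.ne_iff.1 hy
    rw [map_mul, map_prod, Finset.prod_eq_zero (Finset.mem_univ i), mul_zero]
    cases h : a i <;> cases h' : y i <;> simp_all [bF]
  · simp

lemma pdeg_spec (F : Type) [Field F] {n : ℕ} (f : (Fin n → Bool) → Bool) {ε : ℝ} (hε : 0 ≤ ε) :
    ∃ P : ProbPoly F n, (∀ i, (P.poly i).totalDegree ≤ pdeg F f ε) ∧ ∀ a, errAt P f a ≤ ε := by
  obtain ⟨p, hp⟩ := exists_poly F f
  refine Nat.sInf_mem (s := {d | ∃ P : ProbPoly F n, (∀ i, (P.poly i).totalDegree ≤ d) ∧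
    ∀ a, errAt P f a ≤ ε}) ⟨p.totalDegree, ⟨1, fun _ => 1, fun _ => zero_le_one, by simp,
    fun _ => p⟩, fun _ => le_rfl, fun a => ?_⟩
  simp [errAt, hp, hε]

lemma good_of_pdeg (F : Type) [Field F] {n b : ℕ} (h : (Fin n → Bool) → Bool) (spec : ℕ → Bool)
    (hs : ∀ a, h a = spec (wt a)) (hB : Bparam n spec = b) (hb : 1 ≤ b)
    (hz : ∀ i, b ≤ i → i + b ≤ n → spec i = false) {ε : ℝ} (hε : 0 ≤ ε) :
    Good F n b (pdeg F h ε) ε := by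
  classical
  obtain ⟨P, hP, hP'⟩ := pdeg_spec F h hε
  have hor : spec (b - 1) = true ∨ spec (n - (b - 1)) = true := by
    by_contra hcon
    push Not at hcon
    have hlt : b - 1 < sInf {k | ∀ i j, k ≤ i → i + k ≤ n → k ≤ j → j + k ≤ n → spec i = spec j} := by
      change b - 1 < Bparam n spec
      omega
    refine Nat.notMem_of_lt_sInf hlt ?_
    have hall : ∀ i, b - 1 ≤ i → i + (b - 1) ≤ n → spec i = false := by
      intro i h1 h2
      by_cases h3 : i = b - 1
      · simpa [h3] using hcon.1
      by_cases h4 : i = n - (b - 1)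
      · simpa [h4] using hcon.2
      exact hz i (by omega) (by omega)
    intro i j h1 h2 h3 h4
    rw [hall i h1 h2, hall j h3 h4]
  rcases hor with hor | hor
  · refine ⟨Fin P.k, inferInstance, P.w, fun i a => MvPolynomial.eval (fun v => bF F (a v)) (P.poly i),
      P.w_nonneg, P.w_sum, fun i => eval_mem_VV _ (hP i), fun a h1 h2 => ?_⟩
    have : h a = decide (wt a = b - 1) := by
      rw [hs]
      by_cases hw : wt a = b - 1
      · simp [hw, hor]
      · simp [hw, hz (wt a) (by omega) h2]
    rw [← this]
    exact hP' a
  · refine ⟨Fin P.k, inferInstance, P.w,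
      fun i a => MvPolynomial.eval (fun v => bF F (!a v)) (P.poly i),
      P.w_nonneg, P.w_sum, fun i => ?_, fun a h1 h2 => ?_⟩
    · refine comp_mem_VV (fun a v => !a v) (fun v => ?_) (eval_mem_VV _ (hP i))
      have := (VV F (Fin n) 1).sub_mem (one_mem_VV 1) (coord_mem_VV v)
      convert this using 1
      ext x
      cases h : x v <;> simp [bF, h]
    · have hwn := wt_not a
      have : h (fun v => !a v) = decide (wt a = b - 1) := by
        rw [hs]
        by_cases hw : wt a = b - 1
        · have : wt (fun v => !a v) = n - (b - 1) := by omega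
          simp [hw, hor, this]
        · simp [hw, hz (wt fun v => !a v) (by omega) (by omega)]
      rw [← this]
      exact hP' _

/-- lower bound for a `b`-bounded symmetric function `h` with
`b = B(h) ∈ [1, ⌈n/3⌉]` whose spectrum vanishes on `[b, n-b]`. -/
theorem stmt18 :
    ∃ c : ℝ, 0 < c ∧
      ∀ (F : Type) [Field F] (n : ℕ), 2 ≤ n →
        ∀ (h : (Fin n → Bool) → Bool) (spec : ℕ → Bool),
          (∀ a, h a = spec (wt a)) →
          ∀ b : ℕ, Bparam n spec = b → 1 ≤ b → b ≤ (n + 2) / 3 →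
            (∀ i, b ≤ i → i + b ≤ n → spec i = false) →
            ∀ ε : ℝ, 1 / (2:ℝ)^n ≤ ε → ε ≤ 1/3 →
              c * (Real.sqrt (b * Real.logb 2 (1/ε)) + Real.logb 2 (1/ε))
                  / Real.logb 2 n
                ≤ (pdeg F h ε : ℝ) := by
  refine ⟨1 / 5000, by norm_num, ?_⟩
  intro F _ n hn h spec hs b hB hb hbn hz ε hε hε'
  have hpos : 0 < ε := lt_of_lt_of_le (by positivity) hε
  have hg := good_of_pdeg F h spec hs hB hb hz hpos.le
  have hfin := hg.final hb (by omega) hn hε' hε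
  have hn2' : (2 : ℝ) ≤ n := by exact_mod_cast hn
  have hlg : 0 < Real.logb 2 n := Real.logb_pos (by norm_num) (by linarith)
  rw [div_le_iff₀ hlg]
  linarith
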